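/- Let n ≥ 1 and let R be an algebraic Kähler curvature tensor on ℂ^n with CQB₁ ≥ 0. Then for all x, y : Fin n → ℂ and every unit vector z (‖z‖² = 1) one has | Ric(x,ȳ) − ∑_{a,b,c,d} R a b c d · x a · conj (y b) · z c · conj (z d) |² ≤ (n−1)² · Ric(x,x̄) · Ric(y,ȳ). (The estimate with constant D₁ = (n−1)² established in the proof of Theorem 3.1.) -/

import Mathlib

open Finset

/-- An algebraic Kähler curvature tensor on ℂ^n: Kähler symmetries and reality. -/
noncomputable def IsKahlerCurv {n : ℕ} (R : Fin n → Fin n → Fin n → Fin n → ℂ) : Prop :=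
  (∀ a b c d, R a b c d = R c b a d) ∧
  (∀ a b c d, R a b c d = R a d c b) ∧
  (∀ a b c d, star (R a b c d) = R b a d c)

/-- The Ricci tensor `Ric a b = ∑ c, R a b c c`. -/
noncomputable def ricT {n : ℕ} (R : Fin n → Fin n → Fin n → Fin n → ℂ) (a b : Fin n) : ℂ :=
  ∑ c, R a b c c

/-- `Ric(x, ȳ)`. -/
noncomputable def ricForm {n : ℕ} (R : Fin n → Fin n → Fin n → Fin n → ℂ) (x y : Fin n → ℂ) : ℂ :=
  ∑ a, ∑ b, ricT R a b * x a * star (y b)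

/-- The bisectional curvature `R(x, x̄, y, ȳ)`. -/
noncomputable def bisec {n : ℕ} (R : Fin n → Fin n → Fin n → Fin n → ℂ) (x y : Fin n → ℂ) : ℂ :=
  ∑ a, ∑ b, ∑ c, ∑ d, R a b c d * x a * star (x b) * y c * star (y d)

/-- `‖x‖²`. -/
noncomputable def norm2 {n : ℕ} (x : Fin n → ℂ) : ℝ := ∑ a, ‖x a‖ ^ 2

/-- The cross quadratic bisectional curvature quadratic form on matrices. -/
noncomputable def CQB {n : ℕ} (R : Fin n → Fin n → Fin n → Fin n → ℂ)
    (A : Matrix (Fin n) (Fin n) ℂ) : ℝ :=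
  ((∑ a, ∑ b, ∑ c, ricT R a b * A c a * star (A c b)) -
    (∑ a, ∑ b, ∑ c, ∑ d, R a b c d * A a c * star (A b d))).re

open Matrix ComplexOrder in
theorem Matrix.IsHermitian.posSemidef_of_re_nonneg {ι : Type*} [Fintype ι] {M : Matrix ι ι ℂ}
    (hM : M.IsHermitian) (h : ∀ x : ι → ℂ, 0 ≤ (star x ⬝ᵥ M *ᵥ x).re) : M.PosSemidef :=
  .of_dotProduct_mulVec_nonneg hM fun x ↦
    RCLike.nonneg_iff.mpr ⟨h x, hM.im_star_dotProduct_mulVec_self x⟩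

open Matrix ComplexOrder in
/-- Cauchy–Schwarz for a positive semidefinite matrix. -/
theorem Matrix.PosSemidef.norm_dotProduct_mulVec_sq_le {ι : Type*} [Fintype ι]
    {M : Matrix ι ι ℂ} (hM : M.PosSemidef) (x y : ι → ℂ) :
    ‖star y ⬝ᵥ M *ᵥ x‖ ^ 2 ≤ (star x ⬝ᵥ M *ᵥ x).re * (star y ⬝ᵥ M *ᵥ y).re := by
  let := M.toSeminormedAddCommGroup hM
  let := M.toInnerProductSpace hM
  have h := inner_mul_inner_self_le (𝕜 := ℂ) y x
  rw [norm_inner_symm x y, ← sq] at h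
  have key (u v : ι → ℂ) : inner ℂ u v = star u ⬝ᵥ M *ᵥ v := dotProduct_comm _ _
  rw [key, key, key, mul_comm] at h
  exact h

open Matrix ComplexOrder in
/-- A value of a positive semidefinite form on a unit vector is at most its trace. -/
theorem Matrix.PosSemidef.re_dotProduct_mulVec_le_re_trace {ι : Type*} [Fintype ι]
    {M : Matrix ι ι ℂ} (hM : M.PosSemidef) {z : ι → ℂ} (hz : star z ⬝ᵥ z = 1) :
    (star z ⬝ᵥ M *ᵥ z).re ≤ M.trace.re := by
  classical
  set P : Matrix ι ι ℂ := 1 - vecMulVec z (star z) with hP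
  have hPH : Pᴴ = P := by simp [hP, conjTranspose_vecMulVec]
  have hPP : P * P = P := by
    simp [hP, mul_sub, sub_mul, vecMulVec_mul_vecMulVec, hz]
  have h := (hM.mul_mul_conjTranspose_same P).trace_nonneg
  rw [hPH, trace_mul_comm, ← mul_assoc, hPP, hP, sub_mul, one_mul, trace_sub, vecMulVec_mul,
    trace_vecMulVec, dotProduct_comm, ← dotProduct_mulVec] at h
  have h' := (RCLike.nonneg_iff.mp h).1
  simpa using h'

theorem star_dotProduct_self_eq_norm2 {n : ℕ} (z : Fin n → ℂ) :
    star z ⬝ᵥ z = (norm2 z : ℂ) := by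
  simp [dotProduct, norm2, Complex.conj_mul']

/-- The Ricci form as a matrix. -/
noncomputable def ricMatrix {n : ℕ} (R : Fin n → Fin n → Fin n → Fin n → ℂ) :
    Matrix (Fin n) (Fin n) ℂ :=
  Matrix.of fun b a ↦ ricT R a b

/-- The matrix of the form `(x, y) ↦ R(x, ȳ, z, z̄)`. -/
noncomputable def curvMatrix {n : ℕ} (R : Fin n → Fin n → Fin n → Fin n → ℂ) (z : Fin n → ℂ) :
    Matrix (Fin n) (Fin n) ℂ :=
  Matrix.of fun b a ↦ ∑ c, ∑ d, R a b c d * z c * star (z d)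

section

open Matrix

variable {n : ℕ} {R : Fin n → Fin n → Fin n → Fin n → ℂ}

theorem dotProduct_ricMatrix_mulVec (R : Fin n → Fin n → Fin n → Fin n → ℂ) (x y : Fin n → ℂ) :
    star y ⬝ᵥ ricMatrix R *ᵥ x = ricForm R x y := by
  simp only [dotProduct, mulVec, ricMatrix, ricForm, of_apply, mul_sum, Pi.star_apply]
  rw [sum_comm]
  exact sum_congr rfl fun a _ ↦ sum_congr rfl fun b _ ↦ by ring

theorem dotProduct_curvMatrix_mulVec (R : Fin n → Fin n → Fin n → Fin n → ℂ)
    (x y z : Fin n → ℂ) :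
    star y ⬝ᵥ curvMatrix R z *ᵥ x =
      ∑ a, ∑ b, ∑ c, ∑ d, R a b c d * x a * star (y b) * z c * star (z d) := by
  simp only [dotProduct, mulVec, curvMatrix, of_apply, mul_sum, sum_mul, Pi.star_apply]
  rw [sum_comm]
  exact sum_congr rfl fun a _ ↦ sum_congr rfl fun b _ ↦ sum_congr rfl fun c _ ↦
    sum_congr rfl fun d _ ↦ by ring

theorem IsKahlerCurv.swap_pairs (hR : IsKahlerCurv R) (a b c d : Fin n) :
    R a b c d = R c d a b := by
  rw [hR.1, hR.2.1]

theorem IsKahlerCurv.isHermitian_ricMatrix (hR : IsKahlerCurv R) :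
    (ricMatrix R).IsHermitian := by
  ext a b
  simp only [conjTranspose_apply, ricMatrix, of_apply, ricT, star_sum, hR.2.2]

theorem IsKahlerCurv.isHermitian_curvMatrix (hR : IsKahlerCurv R) (z : Fin n → ℂ) :
    (curvMatrix R z).IsHermitian := by
  ext a b
  simp only [conjTranspose_apply, curvMatrix, of_apply, star_sum, star_mul', star_star, hR.2.2]
  rw [sum_comm]
  exact sum_congr rfl fun a _ ↦ sum_congr rfl fun b _ ↦ by ring

theorem IsKahlerCurv.trace_curvMatrix (hR : IsKahlerCurv R) (x : Fin n → ℂ) :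
    (curvMatrix R x).trace = ricForm R x x := by
  simp only [trace, diag_apply, curvMatrix, of_apply, ricForm, ricT, sum_mul]
  rw [sum_comm]
  refine sum_congr rfl fun c _ ↦ ?_
  rw [sum_comm]
  exact sum_congr rfl fun d _ ↦ sum_congr rfl fun a _ ↦ by rw [hR.swap_pairs]

theorem IsKahlerCurv.dotProduct_curvMatrix_mulVec_comm (hR : IsKahlerCurv R) (x y : Fin n → ℂ) :
    star x ⬝ᵥ curvMatrix R y *ᵥ x = star y ⬝ᵥ curvMatrix R x *ᵥ y := by
  rw [dotProduct_curvMatrix_mulVec, dotProduct_curvMatrix_mulVec]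
  calc _ = ∑ a, ∑ c, ∑ d, ∑ b, R a b c d * x a * star (x b) * y c * star (y d) :=
        sum_congr rfl fun a _ ↦ by
          rw [sum_comm]
          exact sum_congr rfl fun c _ ↦ sum_comm
    _ = ∑ c, ∑ d, ∑ a, ∑ b, R a b c d * x a * star (x b) * y c * star (y d) := by
        rw [sum_comm]
        exact sum_congr rfl fun c _ ↦ sum_comm
    _ = _ := sum_congr rfl fun c _ ↦ sum_congr rfl fun d _ ↦ sum_congr rfl fun a _ ↦
        sum_congr rfl fun b _ ↦ by rw [hR.swap_pairs]; ring

theorem CQB_vecMulVec (R : Fin n → Fin n → Fin n → Fin n → ℂ) (u v : Fin n → ℂ) :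
    CQB R (vecMulVec u v) =
      norm2 u * (ricForm R v v).re - (star u ⬝ᵥ curvMatrix R v *ᵥ u).re := by
  rw [CQB, Complex.sub_re, ← Complex.re_ofReal_mul, ← star_dotProduct_self_eq_norm2,
    dotProduct_curvMatrix_mulVec]
  congr 2
  · simp only [vecMulVec_apply, dotProduct, ricForm, mul_sum, sum_mul, star_mul', Pi.star_apply]
    exact sum_congr rfl fun a _ ↦ sum_congr rfl fun b _ ↦ sum_congr rfl fun c _ ↦ by ring
  · simp only [vecMulVec_apply, star_mul']
    exact sum_congr rfl fun a _ ↦ sum_congr rfl fun b _ ↦ sum_congr rfl fun c _ ↦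
      sum_congr rfl fun d _ ↦ by ring

end

/-- The estimate with constant `D₁ = (n−1)²` from the proof of Theorem 3.1:
under `CQB₁ ≥ 0`, `|Ric(x,ȳ) − R(x,ȳ,z,z̄)|² ≤ (n−1)²·Ric(x,x̄)·Ric(y,ȳ)`
for every unit vector `z`. -/
theorem cqb_pinching_estimate (n : ℕ) (hn : 1 ≤ n)
    (R : Fin n → Fin n → Fin n → Fin n → ℂ) (hR : IsKahlerCurv R)
    (hCQB : ∀ A : Matrix (Fin n) (Fin n) ℂ, A.rank ≤ 1 → 0 ≤ CQB R A) :
    ∀ x y z : Fin n → ℂ, norm2 z = 1 →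
      ‖ricForm R x y -
          ∑ a, ∑ b, ∑ c, ∑ d, R a b c d * x a * star (y b) * z c * star (z d)‖ ^ 2 ≤
        ((n : ℝ) - 1) ^ 2 * (ricForm R x x).re * (ricForm R y y).re := by
  intro x y z hz
  have hpos (u v : Fin n → ℂ) :
      0 ≤ norm2 u * (ricForm R v v).re - (star u ⬝ᵥ (curvMatrix R v).mulVec u).re := by
    rw [← CQB_vecMulVec]
    exact hCQB _ (Matrix.rank_vecMulVec_le u v)
  set T := ricMatrix R - curvMatrix R z with hT
  have hTform (u v : Fin n → ℂ) : star v ⬝ᵥ T.mulVec u =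
      ricForm R u v - star v ⬝ᵥ (curvMatrix R z).mulVec u := by
    rw [hT, Matrix.sub_mulVec, dotProduct_sub, dotProduct_ricMatrix_mulVec]
  have hTpos :=
    (hR.isHermitian_ricMatrix.sub (hR.isHermitian_curvMatrix z)).posSemidef_of_re_nonneg
      fun v ↦ by
        rw [hTform, Complex.sub_re, hR.dotProduct_curvMatrix_mulVec_comm]
        simpa [hz] using hpos z v
  have hTle (v : Fin n → ℂ) :
      (star v ⬝ᵥ T.mulVec v).re ≤ ((n : ℝ) - 1) * (ricForm R v v).re := by
    set M : Matrix (Fin n) (Fin n) ℂ := (ricForm R v v).re • 1 - curvMatrix R v with hM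
    have hMform (u : Fin n → ℂ) : (star u ⬝ᵥ M.mulVec u).re =
        norm2 u * (ricForm R v v).re - (star u ⬝ᵥ (curvMatrix R v).mulVec u).re := by
      rw [hM, Matrix.sub_mulVec, dotProduct_sub, Matrix.smul_mulVec, Matrix.one_mulVec,
        dotProduct_smul, star_dotProduct_self_eq_norm2]
      simp [mul_comm]
    have hMherm : M.IsHermitian :=
      (Matrix.isHermitian_one.smul (IsSelfAdjoint.all _)).sub (hR.isHermitian_curvMatrix v)
    have hMpos :=
      hMherm.posSemidef_of_re_nonneg fun u ↦ (hMform u).symm ▸ hpos u v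
    have h := hMpos.re_dotProduct_mulVec_le_re_trace (z := z)
      (by rw [star_dotProduct_self_eq_norm2, hz, Complex.ofReal_one])
    have htr : M.trace.re = ((n : ℝ) - 1) * (ricForm R v v).re := by
      rw [hM, Matrix.trace_sub, Matrix.trace_smul, hR.trace_curvMatrix]
      simp
      ring
    rw [hMform, hz, one_mul, htr] at h
    rwa [hTform, Complex.sub_re, hR.dotProduct_curvMatrix_mulVec_comm]
  have hTnn (v : Fin n → ℂ) : 0 ≤ (star v ⬝ᵥ T.mulVec v).re := hTpos.re_dotProduct_nonneg v
  rw [← dotProduct_curvMatrix_mulVec, ← hTform]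
  calc _ ≤ (star x ⬝ᵥ T.mulVec x).re * (star y ⬝ᵥ T.mulVec y).re :=
        hTpos.norm_dotProduct_mulVec_sq_le x y
    _ ≤ _ := mul_le_mul (hTle x) (hTle y) (hTnn y) ((hTnn x).trans (hTle x))
    _ = _ := by ring
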